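/- Convolution identity for Laguerre polynomials via Clebsch-Gordan coefficients: for k₁, k₂ > 0, nonnegative integers j, n, and real x₁, x₂ ≥ 0 with k = k₁+k₂+j, ∑_{n₁+n₂ = n+j} C^{k₁,k₂,k}_{n₁,n₂,n} √(n₁!/(2k₁)_{n₁}) L_{n₁}^{(2k₁-1)}(x₁) √(n₂!/(2k₂)_{n₂}) L_{n₂}^{(2k₂-1)}(x₂) = √(n!/(2k)_n) L_n^{(2k-1)}(x₁+x₂) · C₁ (-1)^j (x₁+x₂)^j P_j^{(2k₁-1,2k₂-1)}((x₂-x₁)/(x₂+x₁)), where C₁ = (j!/((2k₁)_j (2k₂)_j (2k₁+2k₂+j-1)_j))^{1/2}. -/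

import Mathlib

open Complex Finset

/-- Pochhammer symbol `(a)_n` for complex `a`. -/
noncomputable def poch (a : ℂ) (n : ℕ) : ℂ := ∏ i ∈ Finset.range n, (a + i)

/-- Confluent hypergeometric function `₁F₁(a; b; x)`. -/
noncomputable def F11 (a b x : ℂ) : ℂ :=
  ∑' k : ℕ, poch a k * x ^ k / (poch b k * k.factorial)

/-- Gauss hypergeometric function `₂F₁(a, b; c; x)`. -/
noncomputable def F21 (a b c x : ℂ) : ℂ :=
  ∑' k : ℕ, poch a k * poch b k * x ^ k / (poch c k * k.factorial)

/-- Generalized Laguerre polynomial `L_n^{(α)}(x)`. -/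
noncomputable def laguerre (n : ℕ) (α x : ℂ) : ℂ :=
  poch (α + 1) n / n.factorial * F11 (-(n : ℂ)) (α + 1) x

/-- Real Pochhammer symbol `(a)_n`. -/
noncomputable def pochR (a : ℝ) (n : ℕ) : ℝ := ∏ i ∈ Finset.range n, (a + i)

/-- Auxiliary coefficient: the coefficient of `z₂^{n₂}` (relative to `z₁^{n₁} z₂^{n₂}`,
`n₁ = n+j-n₂`) in `(z₂-z₁)^j z₁^n ₂F₁(-n, 2k₂+j; 2k₁+2k₂+2j; 1-z₂/z₁)`. -/
noncomputable def cgcA (k1 k2 : ℝ) (j n n2 : ℕ) : ℝ :=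
  ∑ m ∈ Finset.range (n + 1),
    (pochR (-(n : ℝ)) m * pochR (2 * k2 + j) m /
        (pochR (2 * k1 + 2 * k2 + 2 * j) m * m.factorial)) *
      ∑ p ∈ Finset.range (m + 1),
        if p ≤ n2 then
          (m.choose p : ℝ) * (j.choose (n2 - p) : ℝ) * (-1) ^ p * (-1) ^ (j - (n2 - p))
        else 0

/-- The normalization constant of the coupled basis vector. -/
noncomputable def cgcN (k1 k2 : ℝ) (j n : ℕ) : ℝ :=
  Real.sqrt (pochR (2 * k1) j * pochR (2 * k2) j * pochR (2 * k1 + 2 * k2 + 2 * j) n /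
    (j.factorial * n.factorial * pochR (2 * k1 + 2 * k2 + j - 1) j))

/-- The `su(1,1)` Clebsch-Gordan coefficient `C^{k₁,k₂,k₁+k₂+j}_{n₁,n₂,n}` for the positive
discrete series tensor product `D⁺(k₁)⊗D⁺(k₂) = ⊕_j D⁺(k₁+k₂+j)`, defined explicitly so
that `∑ C e_{n₁}^{(k₁)}(z₁) e_{n₂}^{(k₂)}(z₂)` is the coupled basis vector; it vanishes
unless `n₁+n₂ = n+j`. -/
noncomputable def CGC (k1 k2 : ℝ) (j n n1 n2 : ℕ) : ℝ :=
  if n1 + n2 = n + j then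
    cgcN k1 k2 j n * cgcA k1 k2 j n n2 *
      Real.sqrt (n1.factorial / pochR (2 * k1) n1) *
      Real.sqrt (n2.factorial / pochR (2 * k2) n2)
  else 0

/-- Jacobi polynomial `P_j^{(a,b)}(r)`. -/
noncomputable def jacobiP (j : ℕ) (a b r : ℂ) : ℂ :=
  poch (a + 1) j / j.factorial * F21 (-(j : ℂ)) ((j : ℂ) + a + b + 1) (a + 1) ((1 - r) / 2)

lemma poch_zero (a : ℂ) : poch a 0 = 1 := by simp [poch]

lemma poch_succ (a : ℂ) (n : ℕ) : poch a (n + 1) = poch a n * (a + n) := by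
  simp [poch, Finset.prod_range_succ]

lemma poch_succ' (a : ℂ) (n : ℕ) : poch a (n + 1) = a * poch (a + 1) n := by
  simp only [poch, Finset.prod_range_succ']
  rw [mul_comm]
  congr 1
  · simp
  · apply Finset.prod_congr rfl
    intro i _
    push_cast; ring

lemma poch_ne {a : ℂ} (h : ∀ i : ℕ, a + i ≠ 0) (n : ℕ) : poch a n ≠ 0 :=
  Finset.prod_ne_zero_iff.2 fun i _ => h i

lemma poch_cast (a : ℝ) (n : ℕ) : ((pochR a n : ℝ) : ℂ) = poch a n := by
  simp [poch, pochR]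

lemma pochR_pos {a : ℝ} (h : 0 < a) (n : ℕ) : 0 < pochR a n :=
  Finset.prod_pos fun i _ => by positivity

lemma poch_neg (n m : ℕ) : poch (-(n : ℂ)) m = (-1) ^ m * (n.choose m : ℂ) * m.factorial := by
  induction m with
  | zero => simp [poch]
  | succ m ih =>
    rw [poch_succ, ih]
    have h : ((n.choose (m + 1) * (m + 1) : ℕ) : ℂ) = (n.choose m : ℂ) * (n - m) := by
      rw [Nat.choose_succ_right_eq]
      by_cases hm : m ≤ n
      · push_cast [Nat.cast_sub hm]; ring
      · rw [Nat.choose_eq_zero_of_lt (by omega)]; simp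
    push_cast at h
    rw [Nat.factorial_succ]
    push_cast
    linear_combination (-(-1) ^ (m + 1) * (m.factorial : ℂ)) * h

lemma poch_neg_eq_zero {n m : ℕ} (h : n < m) : poch (-(n : ℂ)) m = 0 := by
  rw [poch_neg, Nat.choose_eq_zero_of_lt h]; simp

lemma F11_eq (n : ℕ) (b x : ℂ) :
    F11 (-(n : ℂ)) b x = ∑ k ∈ range (n + 1), (n.choose k : ℂ) * ((-x) ^ k / poch b k) := by
  unfold F11
  rw [tsum_eq_sum (s := range (n + 1))]
  · apply Finset.sum_congr rfl
    intro k _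
    rw [poch_neg, neg_pow x]
    have : (k.factorial : ℂ) ≠ 0 := by exact_mod_cast k.factorial_ne_zero
    rw [mul_comm (poch b k), ← div_div]
    rw [show (-1 : ℂ) ^ k * (n.choose k : ℂ) * k.factorial * x ^ k / k.factorial =
      (-1 : ℂ) ^ k * (n.choose k : ℂ) * x ^ k by field_simp]
    ring
  · intro k hk
    rw [poch_neg_eq_zero (by simpa using hk)]; simp

lemma F21_eq (n : ℕ) (s b x : ℂ) :
    F21 (-(n : ℂ)) s b x =
      ∑ k ∈ range (n + 1), (n.choose k : ℂ) * (-1) ^ k * (poch s k / poch b k) * x ^ k := by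
  unfold F21
  rw [tsum_eq_sum (s := range (n + 1))]
  · apply Finset.sum_congr rfl
    intro k _
    rw [poch_neg]
    have : (k.factorial : ℂ) ≠ 0 := by exact_mod_cast k.factorial_ne_zero
    rw [mul_comm (poch b k), ← div_div]
    rw [show (-1 : ℂ) ^ k * (n.choose k : ℂ) * k.factorial * poch s k * x ^ k / k.factorial =
      (-1 : ℂ) ^ k * (n.choose k : ℂ) * poch s k * x ^ k by field_simp]
    ring
  · intro k hk
    rw [poch_neg_eq_zero (by simpa using hk)]; simp

/-- Chu-Vandermonde. -/
lemma chu (i : ℕ) : ∀ (a s : ℂ), (∀ i : ℕ, a + i ≠ 0) →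
    ∑ k ∈ range (i + 1), (i.choose k : ℂ) * (-1) ^ k * (poch s k / poch a k) =
      poch (a - s) i / poch a i := by
  induction i with
  | zero => intro a s _; simp [poch]
  | succ i ih =>
    intro a s h
    have h1 : ∀ i : ℕ, a + 1 + i ≠ 0 := by
      intro i; have := h (i + 1); push_cast at this; convert this using 1; ring
    have e : ∑ k ∈ range (i + 1 + 1), ((i + 1).choose k : ℂ) * (-1) ^ k * (poch s k / poch a k)
      = ∑ k ∈ range (i + 1), (i.choose k : ℂ) * (-1) ^ k * (poch s k / poch a k)
        - s / a * ∑ k ∈ range (i + 1),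
          (i.choose k : ℂ) * (-1) ^ k * (poch (s + 1) k / poch (a + 1) k) := by
      rw [Finset.sum_range_succ', Finset.mul_sum]
      have e2 : ∑ k ∈ range (i + 1), (i.choose k : ℂ) * (-1) ^ k * (poch s k / poch a k)
        = ∑ k ∈ range (i + 1), (i.choose (k + 1) : ℂ) * (-1) ^ (k + 1) *
            (poch s (k + 1) / poch a (k + 1)) + 1 := by
        have := Finset.sum_range_succ'
          (fun k => (i.choose k : ℂ) * (-1) ^ k * (poch s k / poch a k)) (i + 1)
        rw [Finset.sum_range_succ] at this
        simpa [poch_zero] using this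
      rw [e2, add_sub_right_comm, ← Finset.sum_sub_distrib]
      congr 1
      · apply Finset.sum_congr rfl
        intro k _
        rw [poch_succ' s, poch_succ' a, Nat.choose_succ_succ, mul_div_mul_comm]
        push_cast; ring
      · simp [poch_zero]
    rw [e, ih a s h, ih (a + 1) (s + 1) h1]
    have ha : a ≠ 0 := by simpa using h 0
    have hp : a * poch (a + 1) i = poch a i * (a + i) := by rw [← poch_succ', poch_succ]
    have n1 := poch_ne h i
    have n2 := poch_ne h1 i
    have n3 := h i
    have hp' : poch a i = a * poch (a + 1) i / (a + i) := by rw [hp]; field_simp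
    rw [poch_succ, poch_succ, add_sub_add_right_eq_sub, hp']
    field_simp
    ring

lemma poch_refl (b : ℂ) (j i : ℕ) (h : i ≤ j) :
    poch b (j - i) * poch (1 - b - j) i = (-1) ^ i * poch b j := by
  induction i with
  | zero => simp [poch_zero]
  | succ i ih =>
    have ih := ih (by omega)
    obtain ⟨r, rfl⟩ : ∃ r, j = r + (i + 1) := ⟨j - (i + 1), by omega⟩
    rw [show r + (i + 1) - i = r + 1 by omega, poch_succ] at ih
    rw [show r + (i + 1) - (i + 1) = r by omega, poch_succ]
    rw [pow_succ, mul_right_comm, ← ih]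
    push_cast
    ring

lemma jacobi_sum (a b x y : ℂ) (j : ℕ) (ha : ∀ i : ℕ, a + i ≠ 0) (hb : ∀ i : ℕ, b + i ≠ 0) :
    ∑ i ∈ range (j + 1), (j.choose i : ℂ) * (-1) ^ i *
        (x ^ i / poch a i * (y ^ (j - i) / poch b (j - i))) =
      (∑ k ∈ range (j + 1), (j.choose k : ℂ) * (-1) ^ k * (poch (j + a + b - 1) k / poch a k) *
        (x ^ k * (x + y) ^ (j - k))) / poch b j := by
  have e : ∀ k ∈ range (j + 1), (j.choose k : ℂ) * (-1) ^ k *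
      (poch (j + a + b - 1) k / poch a k) * (x ^ k * (x + y) ^ (j - k)) =
      ∑ i ∈ range (j + 1), if k ≤ i then (j.choose i : ℂ) * x ^ i * y ^ (j - i) *
        ((i.choose k : ℂ) * (-1) ^ k * (poch (j + a + b - 1) k / poch a k)) else 0 := by
    intro k hk
    have hk : k ≤ j := by simpa [Nat.lt_succ_iff] using hk
    rw [← Finset.sum_filter]
    have hf : (range (j + 1)).filter (fun i => k ≤ i) = Finset.Ico k (j + 1) := by
      ext i; simp; omega
    rw [hf, Finset.sum_Ico_eq_sum_range, add_pow, show j + 1 - k = j - k + 1 by omega,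
      Finset.mul_sum, Finset.mul_sum]
    apply Finset.sum_congr rfl
    intro r hr
    have hr : r ≤ j - k := by simpa [Nat.lt_succ_iff] using hr
    have hc : (j.choose (k + r) : ℂ) * ((k + r).choose k : ℂ) =
        (j.choose k : ℂ) * ((j - k).choose r : ℂ) := by
      have := Nat.choose_mul (n := j) (k := k + r) (s := k) (by omega)
      rw [show k + r - k = r by omega] at this
      exact_mod_cast this
    rw [show j - (k + r) = j - k - r by omega, pow_add]
    linear_combination (-(x ^ k * x ^ r * y ^ (j - k - r) * (-1) ^ k *
      (poch (j + a + b - 1) k / poch a k))) * hc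
  rw [Finset.sum_congr rfl e, Finset.sum_comm, Finset.sum_div]
  apply Finset.sum_congr rfl
  intro i hi
  have hi : i ≤ j := by simpa [Nat.lt_succ_iff] using hi
  rw [← Finset.sum_filter]
  have hf : (range (j + 1)).filter (fun k => k ≤ i) = range (i + 1) := by
    ext k; simp; omega
  rw [hf, ← Finset.mul_sum, chu i a _ ha]
  have hr := poch_refl b j i hi
  rw [show a - (j + a + b - 1) = 1 - b - j by ring]
  have n1 := poch_ne ha i
  have n2 := poch_ne hb (j - i)
  have n3 := poch_ne hb j
  field_simp
  linear_combination (-(j.choose i : ℂ) * x ^ i * y ^ (j - i)) * hr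

/-- the functional `u^k v^l ↦ x^k y^l / ((a)_k (b)_l)`. -/
noncomputable def SS (a b x y : ℂ) : MvPolynomial (Fin 2) ℂ →ₗ[ℂ] ℂ :=
  (MvPolynomial.basisMonomials (Fin 2) ℂ).constr ℂ
    (fun s => x ^ (s 0) / poch a (s 0) * (y ^ (s 1) / poch b (s 1)))

noncomputable abbrev UU : MvPolynomial (Fin 2) ℂ := MvPolynomial.X 0
noncomputable abbrev VV : MvPolynomial (Fin 2) ℂ := MvPolynomial.X 1

lemma SS_monomial (a b x y : ℂ) (s : Fin 2 →₀ ℕ) :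
    SS a b x y (MvPolynomial.monomial s 1) =
      x ^ (s 0) / poch a (s 0) * (y ^ (s 1) / poch b (s 1)) := by
  have h : MvPolynomial.monomial s (1 : ℂ) = MvPolynomial.basisMonomials (Fin 2) ℂ s := by
    rw [MvPolynomial.coe_basisMonomials]
  rw [SS, h, Module.Basis.constr_basis]

lemma monomial_UV (s : Fin 2 →₀ ℕ) :
    MvPolynomial.monomial s (1 : ℂ) = UU ^ (s 0) * VV ^ (s 1) := by
  rw [MvPolynomial.monomial_eq]
  simp [Finsupp.prod_fintype, Fin.prod_univ_two]

lemma SS_UV (a b x y : ℂ) (k l : ℕ) :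
    SS a b x y (UU ^ k * VV ^ l) = x ^ k / poch a k * (y ^ l / poch b l) := by
  have := monomial_UV (Finsupp.single 0 k + Finsupp.single 1 l)
  have h2 := SS_monomial a b x y (Finsupp.single 0 k + Finsupp.single 1 l)
  rw [this] at h2
  simpa using h2

/-- the raising operator -/
noncomputable def DD (a b : ℂ) (f : MvPolynomial (Fin 2) ℂ) : MvPolynomial (Fin 2) ℂ :=
  UU ^ 2 * MvPolynomial.pderiv 0 f + VV ^ 2 * MvPolynomial.pderiv 1 f + a • (UU * f) + b • (VV * f)

lemma DD_add (a b : ℂ) (f g) : DD a b (f + g) = DD a b f + DD a b g := by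
  simp only [DD, map_add, mul_add, smul_add]; abel

lemma DD_smul (a b r : ℂ) (f) : DD a b (r • f) = r • DD a b f := by
  simp only [DD, Derivation.map_smul]
  simp only [Algebra.smul_def]; ring

lemma DD_sum {ι : Type*} (a b : ℂ) (s : Finset ι) (f : ι → MvPolynomial (Fin 2) ℂ) :
    DD a b (∑ i ∈ s, f i) = ∑ i ∈ s, DD a b (f i) := by
  classical
  induction s using Finset.induction_on with
  | empty => simp [DD]
  | insert i s hi ih => rw [Finset.sum_insert hi, Finset.sum_insert hi, DD_add, ih]

lemma pderiv_ne01 : MvPolynomial.pderiv (0 : Fin 2) VV = 0 := by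
  rw [MvPolynomial.pderiv_X_of_ne (by decide)]
lemma pderiv_ne10 : MvPolynomial.pderiv (1 : Fin 2) UU = 0 := by
  rw [MvPolynomial.pderiv_X_of_ne (by decide)]

lemma pow_aux (p : MvPolynomial (Fin 2) ℂ) (k : ℕ) :
    (k : MvPolynomial (Fin 2) ℂ) * p ^ (k - 1) * p = k * p ^ k := by
  cases k with
  | zero => simp
  | succ k => simp [pow_succ, mul_assoc]

lemma DD_mul_pow (a b : ℂ) (j : ℕ) (g) :
    DD a b ((VV - UU) ^ j * g) = (VV - UU) ^ j * DD (a + j) (b + j) g := by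
  have h := pow_aux (VV - UU) j
  simp only [DD, Derivation.leibniz, Derivation.leibniz_pow, map_sub, pderiv_ne01, pderiv_ne10,
    MvPolynomial.pderiv_X_self, smul_eq_mul, nsmul_eq_mul]
  simp only [Algebra.smul_def, map_add, map_natCast]
  linear_combination (g * (VV + UU)) * h

lemma DD_U (a b : ℂ) (r : ℕ) :
    DD a b (UU ^ r) = (r + a + b) • UU ^ (r + 1) + b • ((VV - UU) * UU ^ r) := by
  have h := pow_aux UU r
  simp only [DD, Derivation.leibniz, Derivation.leibniz_pow, map_sub, pderiv_ne01, pderiv_ne10,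
    MvPolynomial.pderiv_X_self, smul_eq_mul, nsmul_eq_mul]
  simp only [Algebra.smul_def, map_add, map_natCast]
  linear_combination UU * h

lemma DD_UV (a b : ℂ) (k l : ℕ) :
    DD a b (UU ^ k * VV ^ l) = (a + k) • (UU ^ (k + 1) * VV ^ l) +
      (b + l) • (UU ^ k * VV ^ (l + 1)) := by
  have h := pow_aux UU k
  have h' := pow_aux VV l
  simp only [DD, Derivation.leibniz, Derivation.leibniz_pow, map_sub, pderiv_ne01, pderiv_ne10,
    MvPolynomial.pderiv_X_self, smul_eq_mul, nsmul_eq_mul]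
  simp only [Algebra.smul_def, map_add, map_natCast]
  linear_combination (UU * VV ^ l) * h + (UU ^ k * VV) * h'

lemma SS_DD (a b x y : ℂ) (ha : ∀ i : ℕ, a + i ≠ 0) (hb : ∀ i : ℕ, b + i ≠ 0) (f) :
    SS a b x y (DD a b f) = (x + y) * SS a b x y f := by
  induction f using MvPolynomial.induction_on' with
  | add p q hp hq => rw [DD_add, map_add, hp, hq, map_add]; ring
  | monomial s r =>
    have : MvPolynomial.monomial s r = r • (UU ^ (s 0) * VV ^ (s 1)) := by
      rw [← monomial_UV, MvPolynomial.smul_monomial]; simp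
    rw [this, DD_smul, DD_UV]
    simp only [map_smul, map_add, SS_UV, smul_eq_mul, poch_succ]
    have n1 := poch_ne ha (s 0)
    have n2 := poch_ne hb (s 1)
    have n3 := ha (s 0)
    have n4 := hb (s 1)
    field_simp
    ring

/-- homogeneous hypergeometric polynomial -/
noncomputable def HH (b c : ℂ) (N : ℕ) : MvPolynomial (Fin 2) ℂ :=
  ∑ m ∈ range (N + 1), ((N.choose m : ℂ) * (poch b m / poch c m)) • ((VV - UU) ^ m * UU ^ (N - m))

lemma DD_HH (a b : ℂ) (hc : ∀ i : ℕ, a + b + i ≠ 0) (N : ℕ) :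
    DD a b (HH b (a + b) N) = (a + b + N) • HH b (a + b) (N + 1) := by
  have e : ∀ m ∈ range (N + 1), DD a b (((N.choose m : ℂ) * (poch b m / poch (a + b) m)) •
      ((VV - UU) ^ m * UU ^ (N - m))) =
      ((N.choose m : ℂ) * (poch b m / poch (a + b) m) * (a + b + N + m)) •
        ((VV - UU) ^ m * UU ^ (N + 1 - m)) +
      ((N.choose m : ℂ) * (poch b (m + 1) / poch (a + b) (m + 1)) * (a + b + m)) •
        ((VV - UU) ^ (m + 1) * UU ^ (N + 1 - (m + 1))) := by
    intro m hm
    have hm : m ≤ N := by simpa [Nat.lt_succ_iff] using hm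
    rw [DD_smul, DD_mul_pow, DD_U, mul_add, smul_add]
    congr 1
    · rw [mul_smul_comm, smul_smul, show N - m + 1 = N + 1 - m by omega]
      congr 2
      push_cast [Nat.cast_sub hm]; ring
    · rw [mul_smul_comm, smul_smul, show N + 1 - (m + 1) = N - m by omega, ← mul_assoc, ← pow_succ]
      congr 1
      rw [poch_succ, poch_succ]
      have n1 := poch_ne hc m
      have n2 := hc m
      field_simp
  rw [HH, DD_sum, Finset.sum_congr rfl e, Finset.sum_add_distrib, HH, Finset.smul_sum]
  have e1 : ∑ m ∈ range (N + 1),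
      ((N.choose m : ℂ) * (poch b m / poch (a + b) m) * (a + b + N + m)) •
        ((VV - UU) ^ m * UU ^ (N + 1 - m)) = ∑ m ∈ range (N + 1 + 1),
      ((N.choose m : ℂ) * (poch b m / poch (a + b) m) * (a + b + N + m)) •
        ((VV - UU) ^ m * UU ^ (N + 1 - m)) := by
    rw [Finset.sum_range_succ _ (N + 1)]; simp
  rw [e1, Finset.sum_range_succ', Finset.sum_range_succ' _ (N + 1), add_right_comm,
    ← Finset.sum_add_distrib]
  congr 1
  · apply Finset.sum_congr rfl
    intro m hm
    have hm : m ≤ N := by simpa [Nat.lt_succ_iff] using hm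
    rw [← add_smul, smul_smul]
    congr 1
    have h : (N.choose (m + 1) : ℂ) * (m + 1) = (N.choose m : ℂ) * (N - m) := by
      have := Nat.choose_succ_right_eq N m
      rw [← Nat.cast_sub hm]
      exact_mod_cast this
    rw [Nat.choose_succ_succ]
    push_cast
    linear_combination (poch b (m + 1) / poch (a + b) (m + 1)) * h
  · simp [poch_zero]

lemma SS_HH (a b x y : ℂ) (j : ℕ) (ha : ∀ i : ℕ, a + i ≠ 0) (hb : ∀ i : ℕ, b + i ≠ 0)
    (hc : ∀ i : ℕ, a + b + 2 * j + i ≠ 0) (N : ℕ) :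
    SS a b x y ((VV - UU) ^ j * HH (b + j) (a + b + 2 * j) N) =
      (x + y) ^ N / poch (a + b + 2 * j) N * SS a b x y ((VV - UU) ^ j) := by
  have hcc : a + b + 2 * (j : ℂ) = (a + j) + (b + j) := by ring
  induction N with
  | zero => simp [HH, poch_zero]
  | succ N ih =>
    have h1 := SS_DD a b x y ha hb ((VV - UU) ^ j * HH (b + j) (a + b + 2 * j) N)
    rw [DD_mul_pow, hcc, DD_HH _ _ (by rw [← hcc]; exact hc), ← hcc, mul_smul_comm, map_smul, ih,
      smul_eq_mul] at h1
    have n1 := poch_ne hc N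
    have n2 := hc N
    rw [poch_succ]
    apply mul_left_cancel₀ n2
    rw [h1]
    field_simp
    ring

lemma SS_base (a b x y : ℂ) (j : ℕ) (ha : ∀ i : ℕ, a + i ≠ 0) (hb : ∀ i : ℕ, b + i ≠ 0) :
    SS a b x y ((VV - UU) ^ j) =
      (∑ k ∈ range (j + 1), (j.choose k : ℂ) * (-1) ^ k * (poch (j + a + b - 1) k / poch a k) *
        (x ^ k * (x + y) ^ (j - k))) / poch b j := by
  rw [← jacobi_sum a b x y j ha hb]
  have : (VV - UU) ^ j = ∑ i ∈ range (j + 1), ((j.choose i : ℂ) * (-1) ^ i) •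
      (UU ^ i * VV ^ (j - i)) := by
    rw [show VV - UU = -UU + VV by ring, add_pow]
    apply Finset.sum_congr rfl
    intro i _
    rw [neg_pow, Algebra.smul_def]
    simp
    ring
  rw [this, map_sum]
  simp only [map_smul, SS_UV, smul_eq_mul]

lemma SS_one_add (a b x y : ℂ) (n m : ℕ) :
    SS a b (-x) (-y) ((1 + UU) ^ n * (1 + VV) ^ m) =
      F11 (-(n : ℂ)) a x * F11 (-(m : ℂ)) b y := by
  rw [F11_eq, F11_eq, add_comm 1 UU, add_comm 1 VV, add_pow, add_pow, Finset.sum_mul_sum,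
    Finset.sum_mul_sum, map_sum]
  apply Finset.sum_congr rfl
  intro k _
  rw [map_sum]
  apply Finset.sum_congr rfl
  intro l _
  have : UU ^ k * 1 ^ (n - k) * (n.choose k : MvPolynomial (Fin 2) ℂ) *
      (VV ^ l * 1 ^ (m - l) * (m.choose l : MvPolynomial (Fin 2) ℂ)) =
      ((n.choose k : ℂ) * (m.choose l : ℂ)) • (UU ^ k * VV ^ l) := by
    rw [Algebra.smul_def]; simp; ring
  rw [this, map_smul, SS_UV, smul_eq_mul]
  ring

/-- the inner sum of `cgcA` -/
noncomputable def inn (j m n2 : ℕ) : ℂ := ∑ p ∈ Finset.range (m + 1),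
        if p ≤ n2 then
          (m.choose p : ℂ) * (j.choose (n2 - p) : ℂ) * (-1) ^ p * (-1) ^ (j - (n2 - p))
        else 0

lemma inn_sum (j n m : ℕ) (hm : m ≤ n) (z w : MvPolynomial (Fin 2) ℂ) :
    ∑ n2 ∈ range (n + j + 1), inn j m n2 • (z ^ (n + j - n2) * w ^ n2) =
      (w - z) ^ j * ((z - w) ^ m * z ^ (n - m)) := by
  simp only [inn, Finset.sum_smul]
  rw [Finset.sum_comm, show z - w = -w + z by ring, add_pow (-w) z m, Finset.sum_mul,
    Finset.mul_sum]
  apply Finset.sum_congr rfl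
  intro p hp
  have hp : p ≤ m := by simpa [Nat.lt_succ_iff] using hp
  simp only [ite_smul, zero_smul]
  rw [← Finset.sum_filter]
  have hf : (range (n + j + 1)).filter (fun i => p ≤ i) = Finset.Ico p (n + j + 1) := by
    ext i; simp; omega
  rw [hf, Finset.sum_Ico_eq_sum_range, show w - z = w + -z by ring, add_pow w (-z) j,
    Finset.sum_mul]
  symm
  apply Finset.sum_subset_zero_on_sdiff
  · intro i hi; simp at hi ⊢; omega
  · intro q hq
    simp at hq
    rw [show p + q - p = q by omega, Nat.choose_eq_zero_of_lt (show j < q by omega)]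
    simp
  · intro q hq
    have hq : q ≤ j := by simpa [Nat.lt_succ_iff] using hq
    rw [show p + q - p = q by omega, Algebra.smul_def, neg_pow w, neg_pow z]
    rw [show n + j - (p + q) = (j - q) + (m - p) + (n - m) by omega]
    simp only [map_mul, map_natCast, map_pow, map_neg, map_one]
    ring

lemma HH_sum (b c : ℂ) (n : ℕ) :
    ∑ m ∈ range (n + 1), (poch (-(n : ℂ)) m * poch b m / (poch c m * m.factorial)) •
      ((UU - VV) ^ m * (1 + UU) ^ (n - m)) =
    ∑ N ∈ range (n + 1), (n.choose N : ℂ) • HH b c N := by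
  simp only [HH, Finset.smul_sum]
  have e : ∀ N ∈ range (n + 1), ∑ m ∈ range (N + 1), (n.choose N : ℂ) •
      ((N.choose m : ℂ) * (poch b m / poch c m)) • ((VV - UU) ^ m * UU ^ (N - m)) =
      ∑ m ∈ range (n + 1), if m ≤ N then ((n.choose N : ℂ) *
      ((N.choose m : ℂ) * (poch b m / poch c m))) • ((VV - UU) ^ m * UU ^ (N - m)) else 0 := by
    intro N hN
    have hN : N ≤ n := by simpa [Nat.lt_succ_iff] using hN
    rw [← Finset.sum_filter]
    have hf : (range (n + 1)).filter (fun k => k ≤ N) = range (N + 1) := by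
      ext k; simp; omega
    rw [hf]
    simp only [smul_smul]
  rw [Finset.sum_congr rfl e, Finset.sum_comm]
  apply Finset.sum_congr rfl
  intro m hm
  have hm : m ≤ n := by simpa [Nat.lt_succ_iff] using hm
  rw [← Finset.sum_filter]
  have hf : (range (n + 1)).filter (fun i => m ≤ i) = Finset.Ico m (n + 1) := by
    ext i; simp; omega
  rw [hf, Finset.sum_Ico_eq_sum_range, show n + 1 - m = n - m + 1 by omega, add_comm 1 UU, add_pow,
    Finset.mul_sum, Finset.smul_sum]
  apply Finset.sum_congr rfl
  intro r hr
  have hr : r ≤ n - m := by simpa [Nat.lt_succ_iff] using hr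
  have hc : (n.choose (m + r) : ℂ) * ((m + r).choose m : ℂ) =
      (n.choose m : ℂ) * ((n - m).choose r : ℂ) := by
    have := Nat.choose_mul (n := n) (k := m + r) (s := m) (by omega)
    rw [show m + r - m = r by omega] at this
    exact_mod_cast this
  rw [← mul_assoc (n.choose (m + r) : ℂ), hc, poch_neg, show m + r - m = r by omega,
    show UU - VV = -(VV - UU) by ring, neg_pow (VV - UU)]
  have hfac : (m.factorial : ℂ) ≠ 0 := by exact_mod_cast m.factorial_ne_zero
  have : (-1) ^ m * (n.choose m : ℂ) * m.factorial * poch b m / (poch c m * m.factorial) =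
    (-1) ^ m * (n.choose m : ℂ) * (poch b m / poch c m) := by
    rw [mul_comm (poch c m), ← div_div]
    rw [show (-1) ^ m * (n.choose m : ℂ) * m.factorial * poch b m / m.factorial =
      (-1) ^ m * (n.choose m : ℂ) * poch b m by field_simp]
    ring
  rw [this]
  have hs : ((-1 : MvPolynomial (Fin 2) ℂ) ^ m) * (-1) ^ m = 1 := by
    rw [← mul_pow]; simp
  simp only [Algebra.smul_def, map_mul, map_natCast, map_pow, map_neg, map_one, one_pow, mul_one]
  linear_combination ((n.choose m : MvPolynomial (Fin 2) ℂ) *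
    (algebraMap ℂ (MvPolynomial (Fin 2) ℂ)) (poch b m / poch c m) * (VV - UU) ^ m * UU ^ r *
      ((n - m).choose r : MvPolynomial (Fin 2) ℂ)) * hs

lemma cgcA_cast (k1 k2 : ℝ) (j n n2 : ℕ) : ((cgcA k1 k2 j n n2 : ℝ) : ℂ) =
    ∑ m ∈ range (n + 1), (poch (-(n : ℂ)) m * poch (((2 * k2 : ℝ) : ℂ) + j) m /
      (poch (((2 * k1 : ℝ) : ℂ) + ((2 * k2 : ℝ) : ℂ) + 2 * j) m * m.factorial)) * inn j m n2 := by
  unfold cgcA inn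
  push_cast [poch_cast, apply_ite (fun t : ℝ => (t : ℂ))]
  rfl

lemma main_core (k1 k2 : ℝ) (hk1 : 0 < k1) (hk2 : 0 < k2) (j n : ℕ) (x y : ℂ) :
    ∑ n1 ∈ range (n + j + 1), (cgcA k1 k2 j n (n + j - n1) : ℂ) *
      (F11 (-(n1 : ℂ)) ((2 * k1 : ℝ) : ℂ) x *
        F11 (-((n + j - n1 : ℕ) : ℂ)) ((2 * k2 : ℝ) : ℂ) y) =
    F11 (-(n : ℂ)) (((2 * k1 : ℝ) : ℂ) + ((2 * k2 : ℝ) : ℂ) + 2 * j) (x + y) * ((-1) ^ j *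
      (∑ k ∈ range (j + 1), (j.choose k : ℂ) * (-1) ^ k *
        (poch (j + ((2 * k1 : ℝ) : ℂ) + ((2 * k2 : ℝ) : ℂ) - 1) k / poch ((2 * k1 : ℝ) : ℂ) k) *
        (x ^ k * (x + y) ^ (j - k))) / poch ((2 * k2 : ℝ) : ℂ) j) := by
  have pos : ∀ t : ℝ, 0 < t → ∀ i : ℕ, (t : ℂ) + i ≠ 0 := by
    intro t ht i
    have : t + i ≠ 0 := by positivity
    exact_mod_cast this
  have ha := pos (2 * k1) (by positivity)
  have hb := pos (2 * k2) (by positivity)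
  have hc : ∀ i : ℕ, ((2 * k1 : ℝ) : ℂ) + ((2 * k2 : ℝ) : ℂ) + 2 * j + i ≠ 0 := by
    intro i
    have := pos (2 * k1 + 2 * k2 + 2 * j) (by positivity) i
    push_cast at this ⊢
    exact this
  have hA := cgcA_cast k1 k2 j n
  generalize ((2 * k1 : ℝ) : ℂ) = a at *
  generalize ((2 * k2 : ℝ) : ℂ) = b at *
  simp only [← SS_one_add]
  rw [← Finset.sum_range_reflect]
  have e : ∀ i ∈ range (n + j + 1), (cgcA k1 k2 j n (n + j - (n + j + 1 - 1 - i)) : ℂ) *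
      SS a b (-x) (-y) ((1 + UU) ^ (n + j + 1 - 1 - i) *
        (1 + VV) ^ (n + j - (n + j + 1 - 1 - i))) =
      SS a b (-x) (-y) (∑ m ∈ range (n + 1), (poch (-(n : ℂ)) m * poch (b + j) m /
      (poch (a + b + 2 * j) m * m.factorial)) • inn j m i •
        ((1 + UU) ^ (n + j - i) * (1 + VV) ^ i)) := by
    intro i hi
    have hi : i ≤ n + j := by simpa [Nat.lt_succ_iff] using hi
    rw [show n + j + 1 - 1 - i = n + j - i by omega, show n + j - (n + j - i) = i by omega, hA,
      map_sum, Finset.sum_mul]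
    apply Finset.sum_congr rfl
    intro m _
    rw [map_smul, map_smul, smul_eq_mul, smul_eq_mul, mul_assoc]
  rw [Finset.sum_congr rfl e, ← map_sum, Finset.sum_comm]
  have e2 : ∑ m ∈ range (n + 1), ∑ i ∈ range (n + j + 1), (poch (-(n : ℂ)) m * poch (b + j) m /
      (poch (a + b + 2 * j) m * m.factorial)) • inn j m i •
        ((1 + UU) ^ (n + j - i) * (1 + VV) ^ i) =
      ∑ N ∈ range (n + 1), (n.choose N : ℂ) • ((VV - UU) ^ j * HH (b + j) (a + b + 2 * j) N) := by
    simp only [← mul_smul_comm]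
    rw [← Finset.mul_sum, ← HH_sum, Finset.mul_sum]
    apply Finset.sum_congr rfl
    intro m hm
    have hm : m ≤ n := by simpa [Nat.lt_succ_iff] using hm
    have := inn_sum j n m hm (1 + UU) (1 + VV)
    rw [show (1 + VV) - (1 + UU) = VV - UU by ring,
      show (1 + UU) - (1 + VV) = UU - VV by ring] at this
    rw [mul_smul_comm, ← this, Finset.smul_sum]
    simp only [mul_smul_comm]
  rw [e2, map_sum]
  simp only [map_smul, SS_HH a b _ _ j ha hb hc, SS_base a b _ _ j ha hb, smul_eq_mul]
  simp only [← mul_assoc]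
  rw [← Finset.sum_mul, F11_eq]
  congr 1
  · apply Finset.sum_congr rfl
    intro N _
    rw [← neg_add]
  · congr 1
    rw [Finset.mul_sum]
    apply Finset.sum_congr rfl
    intro k hk
    have hk : k ≤ j := by simpa [Nat.lt_succ_iff] using hk
    rw [← neg_add, neg_pow x, neg_pow (x + y)]
    have : (-1 : ℂ) ^ j = (-1) ^ k * (-1) ^ (j - k) := by rw [← pow_add]; congr 1; omega
    rw [this]; ring

lemma jac_eq (j : ℕ) (a b : ℝ) (x1 x2 : ℝ) (hx1 : 0 ≤ x1) (hx2 : 0 ≤ x2) :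
    ((x1 : ℂ) + x2) ^ j * jacobiP j ((a - 1 : ℝ) : ℂ) ((b - 1 : ℝ) : ℂ)
            (((x2 - x1) / (x2 + x1) : ℝ) : ℂ) = poch a j / j.factorial *
      (∑ k ∈ range (j + 1), (j.choose k : ℂ) * (-1) ^ k *
        (poch (j + (a : ℂ) + (b : ℂ) - 1) k / poch a k) *
        ((x1 : ℂ) ^ k * ((x1 : ℂ) + x2) ^ (j - k))) := by
  unfold jacobiP
  rw [F21_eq]
  push_cast
  rw [show (a : ℂ) - 1 + 1 = a by ring,
    show (j : ℂ) + (a - 1) + (b - 1) + 1 = j + a + b - 1 by ring, mul_left_comm, Finset.mul_sum]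
  congr 1
  apply Finset.sum_congr rfl
  intro k hk
  have hk : k ≤ j := by simpa [Nat.lt_succ_iff] using hk
  by_cases h : x1 + x2 = 0
  · have h1 : x1 = 0 := by linarith
    have h2 : x2 = 0 := by linarith
    subst h1 h2
    rcases Nat.eq_zero_or_pos j with rfl | hj
    · have : k = 0 := by omega
      subst this; simp
    · rcases Nat.eq_zero_or_pos k with rfl | hk0
      · simp [hj.ne']
      · simp [hj.ne', hk0.ne']
  · have h' : (x1 : ℂ) + x2 ≠ 0 := by exact_mod_cast h
    have h'' : (x2 : ℂ) + x1 ≠ 0 := by rwa [add_comm]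
    have : (1 - ((x2 : ℂ) - x1) / (x2 + x1)) / 2 = x1 / (x1 + x2) := by
      field_simp; ring
    rw [this, div_pow]
    have hp : ((x1 : ℂ) + x2) ^ j = (x1 + x2) ^ k * (x1 + x2) ^ (j - k) := by
      rw [← pow_add]; congr 1; omega
    rw [hp]
    have := pow_ne_zero k h'
    generalize ((x1 : ℂ) + x2) ^ (j - k) = t
    generalize poch (j + (a : ℂ) + (b : ℂ) - 1) k / poch a k = s
    field_simp

lemma sqrt_lag (a : ℝ) (ha : 0 < a) (n : ℕ) (x : ℂ) :
    (Real.sqrt (n.factorial / pochR a n) : ℂ) * (Real.sqrt (n.factorial / pochR a n) : ℂ) *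
      laguerre n ((a - 1 : ℝ) : ℂ) x = F11 (-(n : ℂ)) a x := by
  have hp := pochR_pos ha n
  have h0 : 0 ≤ (n.factorial : ℝ) / pochR a n := by positivity
  rw [← Complex.ofReal_mul, Real.mul_self_sqrt h0, laguerre]
  push_cast
  rw [show (a : ℂ) - 1 + 1 = a by ring, poch_cast]
  have n1 : poch a n ≠ 0 := by rw [← poch_cast]; exact_mod_cast hp.ne'
  have n2 : (n.factorial : ℂ) ≠ 0 := by exact_mod_cast n.factorial_ne_zero
  field_simp

lemma cgcN_eq (k1 k2 : ℝ) (hk1 : 0 < k1) (hk2 : 0 < k2) (j n : ℕ) :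
    cgcN k1 k2 j n = Real.sqrt (n.factorial / pochR (2 * (k1 + k2 + j)) n) *
      Real.sqrt (j.factorial /
              (pochR (2 * k1) j * pochR (2 * k2) j * pochR (2 * k1 + 2 * k2 + j - 1) j)) *
      (pochR (2 * (k1 + k2 + j)) n / n.factorial * (pochR (2 * k1) j * pochR (2 * k2) j /
        j.factorial)) := by
  have p1 := pochR_pos (a := 2 * k1) (by positivity) j
  have p2 := pochR_pos (a := 2 * k2) (by positivity) j
  have p3 := pochR_pos (a := 2 * (k1 + k2 + j)) (by positivity) n
  have p4 : 0 < pochR (2 * k1 + 2 * k2 + j - 1) j := by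
    cases j with
    | zero => simp [pochR]
    | succ j => apply pochR_pos; push_cast; have : (0 : ℝ) ≤ j := by positivity
                linarith
  unfold cgcN
  rw [show 2 * k1 + 2 * k2 + 2 * (j : ℝ) = 2 * (k1 + k2 + j) by ring]
  generalize pochR (2 * k1) j = A at *
  generalize pochR (2 * k2) j = B at *
  generalize pochR (2 * (k1 + k2 + j)) n = Cc at *
  generalize pochR (2 * k1 + 2 * k2 + j - 1) j = E at *
  have f1 : (0 : ℝ) < n.factorial := by exact_mod_cast n.factorial_pos
  have f2 : (0 : ℝ) < j.factorial := by exact_mod_cast j.factorial_pos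
  generalize (n.factorial : ℝ) = f at *
  generalize (j.factorial : ℝ) = g at *
  rw [← Real.sqrt_mul (by positivity)]
  rw [Real.sqrt_eq_iff_mul_self_eq (by positivity) (by positivity)]
  rw [mul_mul_mul_comm, Real.mul_self_sqrt (by positivity)]
  field_simp

/-- Convolution identity for Laguerre polynomials via the `su(1,1)` Clebsch-Gordan
coefficients: with `k = k₁+k₂+j`,
`∑_{n₁+n₂=n+j} C^{k₁,k₂,k}_{n₁,n₂,n} √(n₁!/(2k₁)_{n₁}) L_{n₁}^{(2k₁-1)}(x₁)
  √(n₂!/(2k₂)_{n₂}) L_{n₂}^{(2k₂-1)}(x₂)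
 = √(n!/(2k)_n) L_n^{(2k-1)}(x₁+x₂) · C₁ (-1)^j (x₁+x₂)^j
   P_j^{(2k₁-1,2k₂-1)}((x₂-x₁)/(x₂+x₁))`. -/
theorem laguerre_jacobi_convolution (k1 k2 : ℝ) (hk1 : 0 < k1) (hk2 : 0 < k2)
    (j n : ℕ) (x1 x2 : ℝ) (hx1 : 0 ≤ x1) (hx2 : 0 ≤ x2) :
    ∑ n1 ∈ Finset.range (n + j + 1),
        (CGC k1 k2 j n n1 (n + j - n1) : ℂ) *
          (Real.sqrt (n1.factorial / pochR (2 * k1) n1) : ℂ) *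
          laguerre n1 ((2 * k1 - 1 : ℝ) : ℂ) (x1 : ℂ) *
          (Real.sqrt ((n + j - n1).factorial / pochR (2 * k2) (n + j - n1)) : ℂ) *
          laguerre (n + j - n1) ((2 * k2 - 1 : ℝ) : ℂ) (x2 : ℂ)
      = (Real.sqrt (n.factorial / pochR (2 * (k1 + k2 + j)) n) : ℂ) *
          laguerre n ((2 * (k1 + k2 + j) - 1 : ℝ) : ℂ) ((x1 : ℂ) + x2) *
          (Real.sqrt (j.factorial /
              (pochR (2 * k1) j * pochR (2 * k2) j * pochR (2 * k1 + 2 * k2 + j - 1) j)) : ℂ) *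
          (-1) ^ j * ((x1 : ℂ) + x2) ^ j *
          jacobiP j ((2 * k1 - 1 : ℝ) : ℂ) ((2 * k2 - 1 : ℝ) : ℂ)
            (((x2 - x1) / (x2 + x1) : ℝ) : ℂ) := by
  have hL : ∀ n1 ∈ Finset.range (n + j + 1),
        (CGC k1 k2 j n n1 (n + j - n1) : ℂ) *
          (Real.sqrt (n1.factorial / pochR (2 * k1) n1) : ℂ) *
          laguerre n1 ((2 * k1 - 1 : ℝ) : ℂ) (x1 : ℂ) *
          (Real.sqrt ((n + j - n1).factorial / pochR (2 * k2) (n + j - n1)) : ℂ) *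
          laguerre (n + j - n1) ((2 * k2 - 1 : ℝ) : ℂ) (x2 : ℂ) =
        (cgcN k1 k2 j n : ℂ) * ((cgcA k1 k2 j n (n + j - n1) : ℂ) *
      (F11 (-(n1 : ℂ)) ((2 * k1 : ℝ) : ℂ) x1 *
        F11 (-((n + j - n1 : ℕ) : ℂ)) ((2 * k2 : ℝ) : ℂ) x2)) := by
    intro n1 h1
    have h1 : n1 ≤ n + j := by simpa [Nat.lt_succ_iff] using h1
    rw [CGC, if_pos (by omega), ← sqrt_lag (2 * k1) (by positivity),
      ← sqrt_lag (2 * k2) (by positivity)]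
    simp only [Complex.ofReal_mul (cgcN k1 k2 j n * _ * _), Complex.ofReal_mul (cgcN k1 k2 j n * _),
      Complex.ofReal_mul (cgcN k1 k2 j n)]
    ring
  rw [Finset.sum_congr rfl hL, ← Finset.mul_sum, main_core k1 k2 hk1 hk2, cgcN_eq k1 k2 hk1 hk2]
  have hj := jac_eq j (2 * k1) (2 * k2) x1 x2 hx1 hx2
  rw [mul_assoc _ (((x1 : ℂ) + x2) ^ j), hj, laguerre]
  have hc : ((2 * (k1 + k2 + j) - 1 : ℝ) : ℂ) + 1 = ((2 * (k1 + k2 + j) : ℝ) : ℂ) := by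
    push_cast; ring
  have hc2 : ((2 * k1 : ℝ) : ℂ) + ((2 * k2 : ℝ) : ℂ) + 2 * j = ((2 * (k1 + k2 + j) : ℝ) : ℂ) := by
    push_cast; ring
  rw [hc, hc2]
  have p2 : poch ((2 * k2 : ℝ) : ℂ) j ≠ 0 := by
    rw [← poch_cast]; exact_mod_cast (pochR_pos (a := 2 * k2) (by positivity) j).ne'
  simp only [Complex.ofReal_mul (_ * _) (_ * _), Complex.ofReal_mul (Real.sqrt _) (Real.sqrt _),
    Complex.ofReal_mul (_ / _) (_ / _), Complex.ofReal_div, Complex.ofReal_natCast,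
    Complex.ofReal_mul (pochR _ _) (pochR _ _), poch_cast]
  generalize (∑ k ∈ range (j + 1), _ : ℂ) = Sg
  generalize F11 _ _ _ = Fg
  generalize poch ((2 * k2 : ℝ) : ℂ) j = B at *
  have f1 : (n.factorial : ℂ) ≠ 0 := by exact_mod_cast n.factorial_ne_zero
  have f2 : (j.factorial : ℂ) ≠ 0 := by exact_mod_cast j.factorial_ne_zero
  field_simp
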